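/- For a > 0, n ≥ 2, and x ∈ ℝⁿ, the Yukawa potential of the Gaussian satisfies ∫_{ℝⁿ} κ_a(x−y) e^{−|y|²} dy = (1/4) ∫_0^∞ e^{−a² t/4} e^{−|x|²/(1+t)} / (1+t)^{n/2} dt, where κ_a(x) = (2π)^{−n/2} (|x|/a)^{1−n/2} K_{n/2−1}(a|x|) is the fundamental solution of −Δ + a². -/

import Mathlib

open Real MeasureTheory

/-- The modified Bessel function of the second kind, via the integral representation
`K_ν(z) = ∫_0^∞ e^(−z cosh t) cosh(ν t) dt` (valid for `z > 0`). -/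
noncomputable def besselK (ν z : ℝ) : ℝ :=
  ∫ t in Set.Ioi (0:ℝ), Real.exp (-z * Real.cosh t) * Real.cosh (ν * t)

/-- The fundamental solution of `−Δ + a²` in `ℝⁿ`. -/
noncomputable def yukawaKernel (n : ℕ) (a : ℝ) (x : EuclideanSpace ℝ (Fin n)) : ℝ :=
  (2 * π) ^ (-(n : ℝ) / 2) * (‖x‖ / a) ^ (1 - (n : ℝ) / 2) * besselK ((n : ℝ) / 2 - 1) (a * ‖x‖)

theorem one_add_sq_div_two_le_cosh (t : ℝ) : 1 + t ^ 2 / 2 ≤ Real.cosh t := by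
  have hcosh : Real.cosh t = 1 + 2 * Real.sinh (t / 2) ^ 2 := by
    have h := Real.cosh_two_mul (t / 2)
    rw [mul_div_cancel₀ t two_ne_zero, Real.cosh_sq] at h
    linarith
  have hsinh : |t / 2| ≤ |Real.sinh (t / 2)| := by
    rw [Real.abs_sinh]
    exact Real.self_le_sinh_iff.2 (abs_nonneg _)
  have := sq_le_sq.2 hsinh
  nlinarith

theorem integrable_exp_neg_mul_sq_add_mul {b : ℝ} (hb : 0 < b) (c : ℝ) :
    Integrable fun t : ℝ => rexp (-b * t ^ 2 + c * t) := by
  have h := ((integrable_exp_neg_mul_sq hb).comp_sub_right (c / (2 * b))).const_mul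
    (rexp (c ^ 2 / (4 * b)))
  refine h.congr (.of_forall fun t => ?_)
  simp only [← Real.exp_add]
  congr 1
  field_simp
  ring

theorem integrable_exp_neg_mul_cosh_mul_exp {z : ℝ} (hz : 0 < z) (c : ℝ) :
    Integrable fun t : ℝ => rexp (-z * Real.cosh t) * rexp (c * t) := by
  refine (integrable_exp_neg_mul_sq_add_mul (half_pos hz) c).mono' (by fun_prop)
    (.of_forall fun t => ?_)
  rw [Real.norm_of_nonneg (by positivity), ← Real.exp_add]
  refine Real.exp_le_exp.2 ?_
  nlinarith [one_add_sq_div_two_le_cosh t]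

/-- The integral representation of `besselK` over the whole line. -/
theorem integral_exp_neg_mul_cosh_mul_exp {z : ℝ} (hz : 0 < z) (ν : ℝ) :
    ∫ t : ℝ, rexp (-z * Real.cosh t) * rexp (-ν * t) = 2 * besselK ν z := by
  have heven : ∫ t : ℝ, rexp (-z * Real.cosh t) * Real.cosh (ν * t) = 2 * besselK ν z := by
    rw [besselK, ← integral_comp_abs]
    refine integral_congr_ae (.of_forall fun t => ?_)
    rcases abs_choice t with h | h <;> simp [h]
  have hneg : ∫ t : ℝ, rexp (-z * Real.cosh t) * rexp (ν * t) =
      ∫ t : ℝ, rexp (-z * Real.cosh t) * rexp (-ν * t) := by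
    rw [← integral_neg_eq_self]
    simp
  have hsum : ∫ t : ℝ, rexp (-z * Real.cosh t) * Real.cosh (ν * t) =
      ((∫ t : ℝ, rexp (-z * Real.cosh t) * rexp (ν * t)) +
        ∫ t : ℝ, rexp (-z * Real.cosh t) * rexp (-ν * t)) / 2 := by
    rw [← integral_add (integrable_exp_neg_mul_cosh_mul_exp hz _)
      (integrable_exp_neg_mul_cosh_mul_exp hz _), ← integral_div]
    refine integral_congr_ae (.of_forall fun t => ?_)
    simp only [Real.cosh_eq (ν * t), neg_mul]
    ring
  linarith

theorem image_const_mul_exp_univ {c : ℝ} (hc : 0 < c) :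
    (fun u : ℝ => c * rexp u) '' Set.univ = Set.Ioi 0 := by
  ext t
  simp only [Set.image_univ, Set.mem_range, Set.mem_Ioi]
  constructor
  · rintro ⟨u, rfl⟩
    positivity
  · intro ht
    refine ⟨Real.log (t / c), ?_⟩
    rw [Real.exp_log (by positivity)]
    field_simp

theorem integral_Ioi_comp_const_mul_exp {c : ℝ} (hc : 0 < c) (g : ℝ → ℝ) :
    ∫ t in Set.Ioi (0 : ℝ), g t = ∫ u : ℝ, c * rexp u * g (c * rexp u) := by
  have h := integral_image_eq_integral_abs_deriv_smul (s := Set.univ)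
    (f := fun u : ℝ => c * rexp u) (f' := fun u => c * rexp u) MeasurableSet.univ
    (fun u _ => ((Real.hasDerivAt_exp u).const_mul c).hasDerivWithinAt)
    (fun u _ v _ huv => Real.exp_injective (mul_left_cancel₀ hc.ne' huv)) g
  rw [image_const_mul_exp_univ hc, Measure.restrict_univ] at h
  rw [h]
  refine integral_congr_ae (.of_forall fun u => ?_)
  simp only [smul_eq_mul]
  rw [abs_of_pos (by positivity)]

/-- The Yukawa kernel as the Laplace transform of the heat kernel. -/
theorem yukawaKernel_eq_integral {n : ℕ} {a : ℝ} (ha : 0 < a)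
    {x : EuclideanSpace ℝ (Fin n)} (hx : x ≠ 0) :
    yukawaKernel n a x = ∫ t in Set.Ioi (0 : ℝ),
      1 / 4 * (rexp (-a ^ 2 * t / 4) * ((π * t) ^ (-(n : ℝ) / 2) * rexp (-‖x‖ ^ 2 / t))) := by
  have hr : 0 < ‖x‖ := norm_pos_iff.2 hx
  set r := ‖x‖
  have hρ : 0 < r / a := by positivity
  have hc : 0 < 2 * (r / a) := by positivity
  rw [integral_Ioi_comp_const_mul_exp hc]
  have hint : ∀ u : ℝ, 2 * (r / a) * rexp u * (1 / 4 * (rexp (-a ^ 2 * (2 * (r / a) * rexp u) / 4) *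
      ((π * (2 * (r / a) * rexp u)) ^ (-(n : ℝ) / 2) * rexp (-r ^ 2 / (2 * (r / a) * rexp u))))) =
      (1 / 2 * (2 * π) ^ (-(n : ℝ) / 2) * (r / a) ^ (1 - (n : ℝ) / 2)) *
        (rexp (-(a * r) * Real.cosh u) * rexp (-((n : ℝ) / 2 - 1) * u)) := by
    intro u
    have hpow : (π * (2 * (r / a) * rexp u)) ^ (-(n : ℝ) / 2) =
        (2 * π) ^ (-(n : ℝ) / 2) * (r / a) ^ (-(n : ℝ) / 2) * rexp (u * (-(n : ℝ) / 2)) := by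
      rw [show π * (2 * (r / a) * rexp u) = 2 * π * (r / a) * rexp u by ring,
        Real.mul_rpow (by positivity) (by positivity), Real.mul_rpow (by positivity) hρ.le,
        ← Real.exp_mul]
    have hρpow : (r / a) ^ (1 - (n : ℝ) / 2) = r / a * (r / a) ^ (-(n : ℝ) / 2) := by
      rw [show 1 - (n : ℝ) / 2 = 1 + -(n : ℝ) / 2 by ring, Real.rpow_add hρ, Real.rpow_one]
    have hcosh : rexp (-(a * r) * Real.cosh u) =
        rexp (-a ^ 2 * (2 * (r / a) * rexp u) / 4) * rexp (-r ^ 2 / (2 * (r / a) * rexp u)) := by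
      rw [← Real.exp_add, Real.cosh_eq, Real.exp_neg]
      congr 1
      field_simp
      ring
    have hexp : rexp (-((n : ℝ) / 2 - 1) * u) = rexp u * rexp (u * (-(n : ℝ) / 2)) := by
      rw [← Real.exp_add]
      congr 1
      ring
    rw [hpow, hρpow, hcosh, hexp]
    ring
  simp_rw [hint]
  rw [integral_const_mul, integral_exp_neg_mul_cosh_mul_exp (by positivity), yukawaKernel]
  ring

section GaussianConvolution

variable {V : Type*} [NormedAddCommGroup V] [InnerProductSpace ℝ V]

theorem exp_neg_norm_sub_sq_div_mul_exp_neg_norm_sq {t : ℝ} (ht : 0 < t) (x y : V) :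
    rexp (-‖x - y‖ ^ 2 / t) * rexp (-‖y‖ ^ 2) =
      rexp (-‖x‖ ^ 2 / (1 + t)) * rexp (-((1 + t) / t) * ‖y - (1 / (1 + t)) • x‖ ^ 2) := by
  have ht' : 0 < 1 + t := by positivity
  rw [← Real.exp_add, ← Real.exp_add, norm_sub_sq_real x y, norm_sub_sq_real y,
    real_inner_smul_right, real_inner_comm y x, norm_smul, Real.norm_of_nonneg (by positivity)]
  congr 1
  field_simp
  ring

variable [FiniteDimensional ℝ V] [MeasurableSpace V] [BorelSpace V]

theorem integrable_exp_neg_norm_sub_sq_div_mul_exp_neg_norm_sq {t : ℝ} (ht : 0 < t) (x : V) :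
    Integrable fun y : V => rexp (-‖x - y‖ ^ 2 / t) * rexp (-‖y‖ ^ 2) := by
  have ht' : 0 < (1 + t) / t := by positivity
  simp_rw [exp_neg_norm_sub_sq_div_mul_exp_neg_norm_sq ht]
  have h : Integrable fun y : V => rexp (-((1 + t) / t) * ‖y‖ ^ 2) := by
    refine Integrable.of_integral_ne_zero ?_
    rw [GaussianFourier.integral_rexp_neg_mul_sq_norm ht']
    positivity
  exact (h.comp_sub_right _).const_mul _

/-- Convolving the standard Gaussian with the heat kernel gives a Gaussian. -/
theorem integral_heatKernel_mul_exp_neg_norm_sq {t : ℝ} (ht : 0 < t) (x : V) :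
    ∫ y : V, (π * t) ^ (-(Module.finrank ℝ V : ℝ) / 2) *
        (rexp (-‖x - y‖ ^ 2 / t) * rexp (-‖y‖ ^ 2)) =
      rexp (-‖x‖ ^ 2 / (1 + t)) / (1 + t) ^ ((Module.finrank ℝ V : ℝ) / 2) := by
  have ht' : 0 < (1 + t) / t := by positivity
  simp_rw [exp_neg_norm_sub_sq_div_mul_exp_neg_norm_sq ht]
  rw [integral_const_mul, integral_const_mul,
    integral_sub_right_eq_self (fun y : V => rexp (-((1 + t) / t) * ‖y‖ ^ 2)),
    GaussianFourier.integral_rexp_neg_mul_sq_norm ht',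
    show π / ((1 + t) / t) = π * t / (1 + t) by field_simp,
    Real.div_rpow (by positivity) (by positivity), neg_div, Real.rpow_neg (by positivity)]
  have : 0 < (π * t) ^ ((Module.finrank ℝ V : ℝ) / 2) := by positivity
  field_simp

end GaussianConvolution

theorem yukawa_potential_of_gaussian (n : ℕ) (hn : 2 ≤ n) (a : ℝ) (ha : 0 < a)
    (x : EuclideanSpace ℝ (Fin n)) :
    (∫ y : EuclideanSpace ℝ (Fin n), yukawaKernel n a (x - y) * Real.exp (-‖y‖ ^ 2)) =
      (1 / 4) * ∫ t in Set.Ioi (0:ℝ),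
        Real.exp (-a ^ 2 * t / 4) * Real.exp (-‖x‖ ^ 2 / (1 + t)) / (1 + t) ^ ((n : ℝ) / 2) := by
  have : Nontrivial (Fin n) := Fin.nontrivial_iff_two_le.2 hn
  set f : ℝ → EuclideanSpace ℝ (Fin n) → ℝ := fun t y =>
    1 / 4 * rexp (-a ^ 2 * t / 4) *
      ((π * t) ^ (-(n : ℝ) / 2) * (rexp (-‖x - y‖ ^ 2 / t) * rexp (-‖y‖ ^ 2))) with hf
  have hkernel : ∀ᵐ y : EuclideanSpace ℝ (Fin n),
      yukawaKernel n a (x - y) * rexp (-‖y‖ ^ 2) = ∫ t in Set.Ioi (0 : ℝ), f t y := by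
    filter_upwards [compl_mem_ae_iff.2 (measure_singleton x)] with y hy
    rw [yukawaKernel_eq_integral ha (sub_ne_zero.2 (Ne.symm hy)), ← integral_mul_const]
    simp only [hf]
    congr 1 with t
    ring
  have hgauss : ∀ t ∈ Set.Ioi (0 : ℝ), ∫ y, f t y = 1 / 4 *
      (rexp (-a ^ 2 * t / 4) * rexp (-‖x‖ ^ 2 / (1 + t)) / (1 + t) ^ ((n : ℝ) / 2)) := by
    intro t ht
    have h := integral_heatKernel_mul_exp_neg_norm_sq ht x
    rw [finrank_euclideanSpace_fin] at h
    simp only [hf]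
    rw [integral_const_mul, h]
    ring
  have hmeas : Measurable (Function.uncurry f) := by
    simp only [hf, Function.uncurry_def]
    fun_prop
  have hbound : Integrable (fun t => ∫ y, f t y) (volume.restrict (Set.Ioi (0 : ℝ))) := by
    refine (exp_neg_integrableOn_Ioi 0 (b := a ^ 2 / 4) (by positivity)).mono'
      hmeas.stronglyMeasurable.integral_prod_right.aestronglyMeasurable ?_
    filter_upwards [ae_restrict_mem measurableSet_Ioi] with t ht
    have ht' : 0 < 1 + t := add_pos one_pos ht
    rw [hgauss t ht, Real.norm_of_nonneg (by positivity)]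
    have h1 : rexp (-‖x‖ ^ 2 / (1 + t)) ≤ 1 :=
      Real.exp_le_one_iff.2 (div_nonpos_of_nonpos_of_nonneg (by simp) ht'.le)
    have h2 : 1 ≤ (1 + t) ^ ((n : ℝ) / 2) :=
      Real.one_le_rpow (by linarith [Set.mem_Ioi.1 ht]) (by positivity)
    have h3 : rexp (-‖x‖ ^ 2 / (1 + t)) / (1 + t) ^ ((n : ℝ) / 2) ≤ 1 :=
      div_le_one_of_le₀ (h1.trans h2) (by positivity)
    have h4 : rexp (-(a ^ 2 / 4) * t) = rexp (-a ^ 2 * t / 4) := by ring_nf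
    rw [h4, mul_div_assoc]
    nlinarith [Real.exp_pos (-a ^ 2 * t / 4)]
  have hint : Integrable (Function.uncurry f)
      ((volume.restrict (Set.Ioi (0 : ℝ))).prod volume) := by
    refine (integrable_prod_iff hmeas.aestronglyMeasurable).2 ⟨?_, ?_⟩
    · filter_upwards [ae_restrict_mem measurableSet_Ioi] with t ht
      simp only [hf, Function.uncurry_apply_pair]
      exact ((integrable_exp_neg_norm_sub_sq_div_mul_exp_neg_norm_sq ht x).const_mul _).const_mul _
    · refine hbound.congr ?_
      filter_upwards [ae_restrict_mem measurableSet_Ioi] with t ht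
      have ht' : 0 < t := ht
      congr 1 with y
      simp only [hf, Function.uncurry_apply_pair]
      rw [Real.norm_of_nonneg (by positivity)]
  rw [integral_congr_ae hkernel, ← integral_integral_swap hint,
    setIntegral_congr_fun measurableSet_Ioi hgauss, integral_const_mul]
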